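/- Let p be a prime, d ≥ 1, q = p^d, n ≥ 1, and 𝔽_q = GaloisField p d. Let ρ' : GL_n(TruncatedWittVector p 2 𝔽_q) → GL_n(𝔽_q) be the group homomorphism induced by the ring homomorphism TruncatedWittVector p 2 𝔽_q → 𝔽_q taking the zeroth Witt component. Then the kernel of ρ' is isomorphic as a group to the additive group of Matrix (Fin n) (Fin n) 𝔽_q; in particular, it is an abelian group of exponent p and order q^{n²}. -/

import Mathlib

open Matrix

noncomputable def wittRed (p : ℕ) [Fact p.Prime] (R : Type*) [CommRing R] :
    TruncatedWittVector p 2 R →+* R where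
  toFun x := x.coeff 0
  map_one' := by
    show TruncatedWittVector.coeff 0 (1 : TruncatedWittVector p 2 R) = 1
    rw [← map_one (WittVector.truncate (p := p) (R := R) 2), WittVector.coeff_truncate]
    simp
  map_zero' := by
    show TruncatedWittVector.coeff 0 (0 : TruncatedWittVector p 2 R) = 0
    rw [← map_zero (WittVector.truncate (p := p) (R := R) 2), WittVector.coeff_truncate]
    simp
  map_mul' := by
    intro x y
    obtain ⟨a, ha⟩ := WittVector.truncate_surjective (p := p) 2 R x
    obtain ⟨b, hb⟩ := WittVector.truncate_surjective (p := p) 2 R y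
    show TruncatedWittVector.coeff 0 (x * y) =
      TruncatedWittVector.coeff 0 x * TruncatedWittVector.coeff 0 y
    rw [← ha, ← hb, ← _root_.map_mul, WittVector.coeff_truncate, WittVector.coeff_truncate,
      WittVector.coeff_truncate]
    exact WittVector.mul_coeff_zero a b
  map_add' := by
    intro x y
    obtain ⟨a, ha⟩ := WittVector.truncate_surjective (p := p) 2 R x
    obtain ⟨b, hb⟩ := WittVector.truncate_surjective (p := p) 2 R y
    show TruncatedWittVector.coeff 0 (x + y) =
      TruncatedWittVector.coeff 0 x + TruncatedWittVector.coeff 0 y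
    rw [← ha, ← hb, ← _root_.map_add, WittVector.coeff_truncate, WittVector.coeff_truncate,
      WittVector.coeff_truncate]
    exact WittVector.add_coeff_zero a b

namespace Matrix

variable {m R S : Type*} [Fintype m] [CommRing R] [CommRing S]

theorem map_val_mul_map_val_eq_zero {I : Ideal R} (hI : ∀ x ∈ I, ∀ y ∈ I, x * y = 0)
    (M N : Matrix m m I) :
    M.map (Subtype.val : I → R) * N.map (Subtype.val : I → R) = 0 := by
  ext i j
  rw [mul_apply]
  exact Finset.sum_eq_zero fun k _ => hI _ (M i k).2 _ (N k j).2

variable [DecidableEq m]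

/-- For an ideal `I` of square zero, the group homomorphism `M ↦ 1 + M` from matrices
over `I` to the general linear group. -/
def oneAddHom (I : Ideal R) (hI : ∀ x ∈ I, ∀ y ∈ I, x * y = 0) :
    Multiplicative (Matrix m m I) →* GL m R where
  toFun M :=
    { val := 1 + M.toAdd.map Subtype.val
      inv := 1 - M.toAdd.map Subtype.val
      val_inv := by
        rw [add_mul, mul_sub, mul_sub, map_val_mul_map_val_eq_zero hI]
        simp
      inv_val := by
        rw [sub_mul, mul_add, mul_add, map_val_mul_map_val_eq_zero hI]
        simp }
  map_one' := by
    ext i j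
    simp
  map_mul' M N := by
    refine Units.ext ?_
    change 1 + (M.toAdd + N.toAdd).map Subtype.val =
      (1 + M.toAdd.map Subtype.val) * (1 + N.toAdd.map Subtype.val)
    rw [mul_add, add_mul, add_mul, map_val_mul_map_val_eq_zero hI]
    ext i j
    simp [add_assoc]

theorem oneAddHom_apply {I : Ideal R} (hI : ∀ x ∈ I, ∀ y ∈ I, x * y = 0)
    (M : Multiplicative (Matrix m m I)) (i j : m) :
    oneAddHom I hI M i j = (1 : Matrix m m R) i j + M.toAdd i j :=
  rfl

theorem oneAddHom_injective {I : Ideal R} (hI : ∀ x ∈ I, ∀ y ∈ I, x * y = 0) :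
    Function.Injective (oneAddHom (m := m) I hI) := by
  intro M N h
  refine Multiplicative.toAdd.injective (Matrix.ext fun i j => Subtype.ext ?_)
  have hij := congrArg (fun g : GL m R => g i j) h
  simpa only [oneAddHom_apply, add_right_inj] using hij

theorem oneAddHom_range_eq_ker (f : R →+* S)
    (hf : ∀ x ∈ RingHom.ker f, ∀ y ∈ RingHom.ker f, x * y = 0) :
    (oneAddHom (m := m) (RingHom.ker f) hf).range = (GeneralLinearGroup.map (n := m) f).ker := by
  ext g
  rw [MonoidHom.mem_range, MonoidHom.mem_ker]
  constructor
  · rintro ⟨M, rfl⟩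
    ext i j
    have hM : f (M.toAdd i j) = 0 := (M.toAdd i j).2
    simp [oneAddHom_apply, hM, one_apply, apply_ite f]
  · intro hg
    have hmem (i j : m) : g i j - (1 : Matrix m m R) i j ∈ RingHom.ker f := by
      have hij := congrArg (fun h : GL m S => h i j) hg
      simp only [GeneralLinearGroup.map_apply] at hij
      rw [RingHom.mem_ker, map_sub, hij]
      simp [one_apply, apply_ite f]
    refine ⟨Multiplicative.ofAdd (of fun i j => ⟨_, hmem i j⟩), ?_⟩
    ext i j
    simp [oneAddHom_apply]

/-- If the kernel of `f` has square zero, the kernel of the induced homomorphism of general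
linear groups is the additive group of matrices over the kernel of `f`. -/
noncomputable def kerMapEquiv (f : R →+* S)
    (hf : ∀ x ∈ RingHom.ker f, ∀ y ∈ RingHom.ker f, x * y = 0) :
    (GeneralLinearGroup.map (n := m) f).ker ≃* Multiplicative (Matrix m m (RingHom.ker f)) :=
  ((MonoidHom.ofInjective (oneAddHom_injective hf)).trans
    (MulEquiv.subgroupCongr (oneAddHom_range_eq_ker f hf))).symm

end Matrix

section WittRed

variable {p : ℕ} [Fact p.Prime] {R : Type*} [CommRing R]

theorem wittRed_truncate (x : WittVector p R) :
    wittRed p R (WittVector.truncate 2 x) = x.coeff 0 :=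
  WittVector.coeff_truncate x 0

theorem exists_truncate_verschiebung_of_mem_ker_wittRed {x : TruncatedWittVector p 2 R}
    (hx : x ∈ RingHom.ker (wittRed p R)) :
    ∃ a : WittVector p R, WittVector.truncate 2 (WittVector.verschiebung a) = x := by
  refine ⟨WittVector.mk p fun _ => x.coeff 1, TruncatedWittVector.ext fun i => ?_⟩
  rw [WittVector.coeff_truncate]
  fin_cases i
  · exact (WittVector.verschiebung_coeff_zero _).trans hx.symm
  · exact WittVector.verschiebung_coeff_add_one _ 0

theorem coeff_one_truncate_verschiebung (a : WittVector p R) :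
    (WittVector.truncate 2 (WittVector.verschiebung a)).coeff 1 = a.coeff 0 :=
  (WittVector.coeff_truncate _ 1).trans (WittVector.verschiebung_coeff_add_one a 0)

theorem mul_eq_zero_of_mem_ker_wittRed [CharP R p] :
    ∀ x ∈ RingHom.ker (wittRed p R), ∀ y ∈ RingHom.ker (wittRed p R), x * y = 0 := by
  intro x hx y hy
  obtain ⟨a, rfl⟩ := exists_truncate_verschiebung_of_mem_ker_wittRed hx
  obtain ⟨b, rfl⟩ := exists_truncate_verschiebung_of_mem_ker_wittRed hy
  rw [← map_mul, ← WittVector.verschiebung_mul_frobenius, WittVector.frobenius_verschiebung,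
    ← mul_assoc]
  refine TruncatedWittVector.ext fun i => ?_
  rw [TruncatedWittVector.coeff_zero]
  fin_cases i
  · exact (WittVector.coeff_truncate _ _).trans (WittVector.verschiebung_coeff_zero _)
  · exact (coeff_one_truncate_verschiebung _).trans (WittVector.mul_charP_coeff_zero _)

variable (p R) in
/-- The kernel of `W₂(R) → R` is the additive group of `R`, through the last Witt component. -/
def kerWittRedEquiv : RingHom.ker (wittRed p R) ≃+ R where
  toFun x := x.1.coeff 1
  invFun a := ⟨TruncatedWittVector.mk p ![0, a], rfl⟩
  left_inv x := by
    refine Subtype.ext (TruncatedWittVector.ext fun i => ?_)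
    fin_cases i
    · exact x.2.symm
    · rfl
  right_inv a := rfl
  map_add' := by
    rintro ⟨x, hx⟩ ⟨y, hy⟩
    obtain ⟨a, rfl⟩ := exists_truncate_verschiebung_of_mem_ker_wittRed hx
    obtain ⟨b, rfl⟩ := exists_truncate_verschiebung_of_mem_ker_wittRed hy
    change TruncatedWittVector.coeff 1 (WittVector.truncate 2 _ + WittVector.truncate 2 _) = _
    rw [← map_add, ← map_add]
    simp only [coeff_one_truncate_verschiebung, WittVector.add_coeff_zero]

end WittRed

/-- **Lemma 2.3 of Stasinski–Vera-Gajardo for `GLₙ` over `W₂(𝔽_q)`.** The kernel of the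
reduction `ρ' : GLₙ(W₂(𝔽_q)) → GLₙ(𝔽_q)` is isomorphic as a group to the additive group
of `Mₙ(𝔽_q)`; in particular it is abelian, of exponent `p`, and of order `q ^ (n²)`. -/
theorem kernel_iso_lie_algebra_wittVector
    (p d n : ℕ) [Fact p.Prime] (hd : 1 ≤ d) (hn : 1 ≤ n) (q : ℕ) (hq : q = p ^ d)
    (ρ' : GL (Fin n) (TruncatedWittVector p 2 (GaloisField p d)) →*
      GL (Fin n) (GaloisField p d))
    (hρ' : ρ' = Matrix.GeneralLinearGroup.map (wittRed p (GaloisField p d))) :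
    Nonempty ((MonoidHom.ker ρ') ≃*
        Multiplicative (Matrix (Fin n) (Fin n) (GaloisField p d))) ∧
      (∀ g ∈ MonoidHom.ker ρ', g ^ p = 1) ∧
      (∀ g ∈ MonoidHom.ker ρ', ∀ h ∈ MonoidHom.ker ρ', g * h = h * g) ∧
      Nat.card (MonoidHom.ker ρ') = q ^ (n ^ 2) := by
  subst hq hρ'
  let e : (GeneralLinearGroup.map (n := Fin n) (wittRed p (GaloisField p d))).ker ≃*
      Multiplicative (Matrix (Fin n) (Fin n) (GaloisField p d)) :=
    (kerMapEquiv _ mul_eq_zero_of_mem_ker_wittRed).trans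
      (AddEquiv.toMultiplicative (kerWittRedEquiv p (GaloisField p d)).mapMatrix)
  refine ⟨⟨e⟩, fun g hg => ?_, fun g hg h hh => ?_, ?_⟩
  · have hpow : (⟨g, hg⟩ : MonoidHom.ker _) ^ p = 1 := by
      refine e.injective (Multiplicative.toAdd.injective ?_)
      rw [map_pow, map_one, toAdd_pow, toAdd_one]
      ext i j
      simp [nsmul_eq_mul]
    exact congrArg Subtype.val hpow
  · have hcomm : (⟨g, hg⟩ : MonoidHom.ker _) * ⟨h, hh⟩ = ⟨h, hh⟩ * ⟨g, hg⟩ :=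
      e.injective (by rw [map_mul, map_mul, mul_comm])
    exact congrArg Subtype.val hcomm
  · rw [Nat.card_congr (e.toEquiv.trans Multiplicative.toAdd)]
    change Nat.card (Fin n → Fin n → GaloisField p d) = _
    simp only [Nat.card_fun, Nat.card_fin, GaloisField.card p d (Nat.one_le_iff_ne_zero.mp hd)]
    rw [← pow_mul, sq]
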